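/- arXiv:2305.08194 — 2 statements merged into one kernel-verified Lean document; each statement's English description precedes it below -/
import Mathlib

section
/- For every natural number m ≥ 2 and every continuous function F : [0,1]^m → ℝ, there exist continuous functions Φ^k : ℝ → ℝ for k = 1,…,2m+1 and continuous functions f^{kj} : [0,1] → ℝ for k = 1,…,2m+1 and j = 1,…,m, such that for all (X_1,…,X_m) ∈ [0,1]^m one has F(X_1,…,X_m) = Σ_{k=1}^{2m+1} Φ^k( Σ_{j=1}^{m} f^{kj}(X_j) ). -/
open scoped BoundedContinuousFunction unitInterval

namespace KolmogorovArnold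

/-- A continuous linear map of Banach spaces with uniformly good approximate preimages is onto. -/
theorem surjective_of_approx {E G : Type*} [NormedAddCommGroup E] [NormedSpace ℝ E]
    [CompleteSpace E] [NormedAddCommGroup G] [NormedSpace ℝ G] (T : E →L[ℝ] G) {C θ : ℝ}
    (hθ₀ : 0 ≤ θ) (hθ₁ : θ < 1) (h : ∀ y, ∃ x, ‖x‖ ≤ C * ‖y‖ ∧ ‖y - T x‖ ≤ θ * ‖y‖) :
    Function.Surjective T := by
  intro y
  choose g hg hr using h
  let r : ℕ → G := fun n => (fun z => z - T (g z))^[n] y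
  have hr_succ : ∀ n, r (n + 1) = r n - T (g (r n)) := fun n => by
    simp only [r, Function.iterate_succ_apply']
  have hr_le : ∀ n, ‖r n‖ ≤ θ ^ n * ‖y‖ := by
    intro n
    induction n with
    | zero => simp [r]
    | succ n ih =>
      rw [hr_succ, pow_succ']
      calc ‖r n - T (g (r n))‖ ≤ θ * ‖r n‖ := hr _
        _ ≤ θ * (θ ^ n * ‖y‖) := by gcongr
        _ = θ * θ ^ n * ‖y‖ := by ring
  have hsum : Summable fun n => g (r n) := by
    refine Summable.of_norm_bounded
      (((summable_geometric_of_lt_one hθ₀ hθ₁).mul_right ‖y‖).mul_left |C|) fun n => ?_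
    calc ‖g (r n)‖ ≤ C * ‖r n‖ := hg _
      _ ≤ |C| * ‖r n‖ := by gcongr; exact le_abs_self C
      _ ≤ |C| * (θ ^ n * ‖y‖) := by gcongr; exact hr_le n
  have hpartial : ∀ n, T (∑ i ∈ Finset.range n, g (r i)) = y - r n := by
    intro n
    induction n with
    | zero => simp [r]
    | succ n ih => rw [Finset.sum_range_succ, map_add, ih, hr_succ]; abel
  have hr_lim : Filter.Tendsto r Filter.atTop (nhds 0) := by
    refine squeeze_zero_norm hr_le ?_
    simpa using (tendsto_pow_atTop_nhds_zero_of_lt_one hθ₀ hθ₁).mul_const ‖y‖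
  refine ⟨∑' n, g (r n), tendsto_nhds_unique
    ((T.continuous.tendsto _).comp hsum.hasSum.tendsto_sum_nat) ?_⟩
  have := (tendsto_const_nhds (x := y)).sub hr_lim
  rw [sub_zero] at this
  exact this.congr fun n => (hpartial n).symm

theorem exists_rat_ne_zero_mul_near {b : ℝ} (hb : b ≠ 0) (a : ℝ) {ε : ℝ} (hε : 0 < ε) :
    ∃ q : ℚ, q ≠ 0 ∧ |(q : ℝ) * b - a| < ε := by
  have hb' : 0 < |b| := abs_pos.2 hb
  have hδ : 0 < ε / |b| := div_pos hε hb'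
  obtain ⟨q, hq, hqa⟩ : ∃ q : ℚ, q ≠ 0 ∧ |(q : ℝ) - a / b| < ε / |b| := by
    rcases le_or_gt 0 (a / b) with h | h
    · obtain ⟨q, h₁, h₂⟩ := exists_rat_btwn (lt_add_of_pos_right (a / b) hδ)
      refine ⟨q, ?_, by rw [abs_lt]; constructor <;> linarith⟩
      rintro rfl
      norm_num at h₁
      linarith
    · obtain ⟨q, h₁, h₂⟩ := exists_rat_btwn (sub_lt_self (a / b) hδ)
      refine ⟨q, ?_, by rw [abs_lt]; constructor <;> linarith⟩
      rintro rfl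
      norm_num at h₂
      linarith
  refine ⟨q, hq, ?_⟩
  have : (q : ℝ) * b - a = (q - a / b) * b := by field_simp
  rw [this, abs_mul]
  exact (lt_div_iff₀ hb').1 hqa

/-- A finite real array can be perturbed so that the sums obtained by choosing one entry in each
row are pairwise distinct. -/
theorem exists_near_injective_sum {ι κ : Type*} [Fintype ι] [Fintype κ] (a : ι → κ → ℝ) {ε : ℝ}
    (hε : 0 < ε) : ∃ c : ι → κ → ℝ, (∀ j i, |c j i - a j i| < ε) ∧
      Function.Injective fun s : ι → κ => ∑ j, c j (s j) := by
  classical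
  let B := Module.Basis.ofVectorSpace ℚ ℝ
  have hB : Infinite (Module.Basis.ofVectorSpaceIndex ℚ ℝ) := by
    rw [Cardinal.infinite_iff, B.mk_eq_rank'', Real.rank_rat_real]
    exact Cardinal.aleph0_le_continuum
  obtain ⟨e⟩ : Nonempty (ι × κ ↪ Module.Basis.ofVectorSpaceIndex ℚ ℝ) :=
    ⟨(Fintype.equivFin (ι × κ)).toEmbedding.trans
      (Fin.valEmbedding.trans (Infinite.natEmbedding _))⟩
  have hli : LinearIndependent ℚ (fun p => B (e p)) := B.linearIndependent.comp e e.injective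
  choose q hq hqa using fun j i => exists_rat_ne_zero_mul_near (hli.ne_zero (j, i)) (a j i) hε
  refine ⟨fun j i => q j i * B (e (j, i)), hqa, fun s s' hs => ?_⟩
  simp only at hs
  have key := Fintype.linearIndependent_iff.1 hli
    (fun p => (if s p.1 = p.2 then q p.1 p.2 else 0) - (if s' p.1 = p.2 then q p.1 p.2 else 0)) (by
      simp only [Fintype.sum_prod_type, sub_smul, Finset.sum_sub_distrib, ite_smul, zero_smul,
        Finset.sum_ite_eq, Finset.mem_univ, if_true, Rat.smul_def]
      exact sub_eq_zero.2 hs)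
  funext j
  by_contra hne
  have := key (j, s j)
  simp only [if_true, if_neg (Ne.symm hne), sub_zero] at this
  exact hq _ _ this

/-- The ramp from `0` to `1` of slope `K` starting at the origin. -/
noncomputable def ramp (K v : ℝ) : ℝ := max 0 (min 1 (K * v))

theorem ramp_nonneg (K v : ℝ) : 0 ≤ ramp K v := le_max_left _ _

theorem ramp_le_one (K v : ℝ) : ramp K v ≤ 1 := max_le zero_le_one (min_le_left _ _)

theorem ramp_eq_one {K v : ℝ} (h : 1 ≤ K * v) : ramp K v = 1 := by
  simp [ramp, min_eq_left h]

theorem ramp_eq_zero {K v : ℝ} (h : K * v ≤ 0) : ramp K v = 0 :=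
  max_eq_left ((min_le_right _ _).trans h)

/-- The piecewise linear function rising from `c i` to `c (i + 1)` on `[i, i + 1 / K]` and staying
at `c (i + 1)` on `[i + 1 / K, i + 1]`, for `i < M`. -/
noncomputable def staircase (K : ℝ) (c : ℕ → ℝ) (M : ℕ) (w : ℝ) : ℝ :=
  c 0 + ∑ i ∈ Finset.range M, (c (i + 1) - c i) * ramp K (w - i)

theorem continuous_staircase (K : ℝ) (c : ℕ → ℝ) (M : ℕ) : Continuous (staircase K c M) := by
  unfold staircase ramp
  fun_prop

theorem staircase_eq {K : ℝ} (hK : 1 ≤ K) (c : ℕ → ℝ) {M n : ℕ} (hn : n < M) {w : ℝ}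
    (h₁ : (n : ℝ) ≤ w) (h₂ : w < n + 1) :
    staircase K c M w = c n + (c (n + 1) - c n) * ramp K (w - n) := by
  obtain ⟨d, rfl⟩ : ∃ d, M = n + 1 + d := ⟨M - (n + 1), by omega⟩
  have hlow : ∑ i ∈ Finset.range n, (c (i + 1) - c i) * ramp K (w - i) = c n - c 0 := by
    rw [← Finset.sum_range_sub]
    refine Finset.sum_congr rfl fun i hi => ?_
    have : (i : ℝ) + 1 ≤ n := by exact_mod_cast Finset.mem_range.1 hi
    rw [ramp_eq_one (by nlinarith), mul_one]
  have hhigh : ∑ i ∈ Finset.range d, (c (n + 1 + i + 1) - c (n + 1 + i)) *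
      ramp K (w - ((n + 1 + i : ℕ) : ℝ)) = 0 := by
    refine Finset.sum_eq_zero fun i _ => ?_
    have : (0 : ℝ) ≤ i := i.cast_nonneg
    rw [ramp_eq_zero (by push_cast; nlinarith), mul_zero]
  rw [staircase, Finset.sum_range_add, Finset.sum_range_succ, hlow, hhigh]
  ring

theorem gridIndex_lt {N : ℕ} {s : ℝ} (hs : s ≤ 1) (t : I) :
    ⌊(N : ℝ) * t + s⌋₊ + 1 < N + 3 := by
  have : ⌊(N : ℝ) * t + s⌋₊ ≤ N + 1 := by
    refine Nat.floor_le_of_le ?_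
    push_cast
    have := mul_le_of_le_one_right (Nat.cast_nonneg (α := ℝ) N) t.2.2
    linarith
  omega

/-- The node of index `i` of the grid of mesh `1 / N` shifted by `s / N`, clamped to `[0, 1]`. -/
noncomputable def node (N : ℕ) (s : ℝ) (i : ℕ) : I :=
  Set.projIcc 0 1 zero_le_one ((i - s) / N)

theorem dist_node_le {N : ℕ} (hN : 0 < N) {s : ℝ} {t : I} {i : ℕ}
    (h : |(N : ℝ) * t + s - i| ≤ 1) : dist (node N s i) t ≤ 1 / N := by
  have hN' : (0 : ℝ) < N := by exact_mod_cast hN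
  have ht : t = Set.projIcc 0 1 zero_le_one (t : ℝ) := (Set.projIcc_val _ _).symm
  rw [dist_comm, Subtype.dist_eq, Real.dist_eq, node]
  nth_rewrite 1 [ht]
  refine (Set.abs_projIcc_sub_projIcc _).trans ?_
  have : (t : ℝ) - (i - s) / N = (N * t + s - i) / N := by field_simp; ring
  rw [this, abs_div, abs_of_pos hN']
  gcongr

/-- The staircase function on `[0, 1]` with `N` steps per unit length, shifted by `s`. -/
noncomputable def stair (K : ℝ) (N : ℕ) (s : ℝ) (c : Fin (N + 3) → ℝ) : C(I, ℝ) where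
  toFun t := staircase K (fun i => c (Fin.ofNat (N + 3) i)) (N + 2) (N * t + s)
  continuous_toFun := (continuous_staircase _ _ _).comp (by fun_prop)

theorem stair_apply {K : ℝ} (hK : 1 ≤ K) {N : ℕ} {s : ℝ} (hs₀ : 0 ≤ s) (hs₁ : s ≤ 1)
    (c : Fin (N + 3) → ℝ) (t : I) :
    stair K N s c t = c ⟨⌊(N : ℝ) * t + s⌋₊, (Nat.lt_succ_self _).trans (gridIndex_lt hs₁ t)⟩ +
      (c ⟨⌊(N : ℝ) * t + s⌋₊ + 1, gridIndex_lt hs₁ t⟩ -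
        c ⟨⌊(N : ℝ) * t + s⌋₊, (Nat.lt_succ_self _).trans (gridIndex_lt hs₁ t)⟩) *
      ramp K (N * t + s - ⌊(N : ℝ) * t + s⌋₊) := by
  have hw : 0 ≤ (N : ℝ) * t + s := add_nonneg (mul_nonneg N.cast_nonneg t.2.1) hs₀
  have hlt := gridIndex_lt (N := N) hs₁ t
  have h₀ : Fin.ofNat (N + 3) ⌊(N : ℝ) * t + s⌋₊ =
      ⟨⌊(N : ℝ) * t + s⌋₊, (Nat.lt_succ_self _).trans hlt⟩ :=
    Fin.ext (Nat.mod_eq_of_lt ((Nat.lt_succ_self _).trans hlt))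
  have h₁ : Fin.ofNat (N + 3) (⌊(N : ℝ) * t + s⌋₊ + 1) = ⟨⌊(N : ℝ) * t + s⌋₊ + 1, hlt⟩ :=
    Fin.ext (Nat.mod_eq_of_lt hlt)
  have := staircase_eq hK (fun i => c (Fin.ofNat (N + 3) i)) (M := N + 2) (by omega)
    (Nat.floor_le hw) (Nat.lt_floor_add_one _)
  simp only [h₀, h₁] at this
  exact this

theorem abs_stair_sub_le {K : ℝ} (hK : 1 ≤ K) {N : ℕ} {s : ℝ} (hs₀ : 0 ≤ s) (hs₁ : s ≤ 1)
    {c : Fin (N + 3) → ℝ} {t : I} {y ε : ℝ}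
    (h : ∀ i : Fin (N + 3), |(N : ℝ) * t + s - (i : ℕ)| ≤ 1 → |c i - y| ≤ ε) :
    |stair K N s c t - y| ≤ ε := by
  have hw : 0 ≤ (N : ℝ) * t + s := add_nonneg (mul_nonneg N.cast_nonneg t.2.1) hs₀
  have hlt := gridIndex_lt (N := N) hs₁ t
  have hf₁ := Nat.floor_le hw
  have hf₂ := Nat.lt_floor_add_one ((N : ℝ) * t + s)
  have h₀ := abs_le.1 (h ⟨⌊(N : ℝ) * t + s⌋₊, (Nat.lt_succ_self _).trans hlt⟩
    (by rw [abs_le]; constructor <;> simp only <;> linarith))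
  have h₁ := abs_le.1 (h ⟨⌊(N : ℝ) * t + s⌋₊ + 1, hlt⟩
    (by rw [abs_le]; constructor <;> push_cast <;> linarith))
  rw [stair_apply hK hs₀ hs₁]
  have hr₀ := ramp_nonneg K (N * t + s - ⌊(N : ℝ) * t + s⌋₊)
  have hr₁ := ramp_le_one K (N * t + s - ⌊(N : ℝ) * t + s⌋₊)
  rw [abs_le]
  constructor <;> nlinarith

theorem stair_eq_of_le_fract {K : ℝ} (hK : 1 ≤ K) {N : ℕ} {s : ℝ} (hs₀ : 0 ≤ s) (hs₁ : s ≤ 1)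
    (c : Fin (N + 3) → ℝ) {t : I} (h : 1 ≤ K * Int.fract ((N : ℝ) * t + s)) :
    stair K N s c t = c ⟨⌊(N : ℝ) * t + s⌋₊ + 1, gridIndex_lt hs₁ t⟩ := by
  have hw : 0 ≤ (N : ℝ) * t + s := add_nonneg (mul_nonneg N.cast_nonneg t.2.1) hs₀
  rw [stair_apply hK hs₀ hs₁, ramp_eq_one]
  · ring
  · rwa [natCast_floor_eq_intCast_floor hw]

/-- Each real number lies in at most one of the `K` shifted families of gaps. -/
theorem eq_of_fract_lt {K : ℕ} (x : ℝ) {k l : Fin K}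
    (hk : (K : ℝ) * Int.fract (x + (1 - k / K)) < 1)
    (hl : (K : ℝ) * Int.fract (x + (1 - l / K)) < 1) : k = l := by
  have hK : (0 : ℝ) < K := by exact_mod_cast k.pos
  set a := ⌊x + (1 - (k : ℝ) / K)⌋ with ha
  set b := ⌊x + (1 - (l : ℝ) / K)⌋ with hb
  have hk₀ := mul_nonneg hK.le (Int.fract_nonneg (x + (1 - (k : ℝ) / K)))
  have hl₀ := mul_nonneg hK.le (Int.fract_nonneg (x + (1 - (l : ℝ) / K)))
  have ek : (K : ℝ) * Int.fract (x + (1 - k / K)) = K * x + K - k - K * a := by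
    rw [Int.fract, ← ha]; field_simp; ring
  have el : (K : ℝ) * Int.fract (x + (1 - l / K)) = K * x + K - l - K * b := by
    rw [Int.fract, ← hb]; field_simp; ring
  rw [ek] at hk hk₀
  rw [el] at hl hl₀
  have h₁ : ((k : ℤ) + K * a) < l + K * b + 1 := by
    have : ((k : ℝ) + K * a) < l + K * b + 1 := by linarith
    exact_mod_cast this
  have h₂ : ((l : ℤ) + K * b) < k + K * a + 1 := by
    have : ((l : ℝ) + K * b) < k + K * a + 1 := by linarith
    exact_mod_cast this
  have heq : (k : ℤ) + K * a = l + K * b := by omega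
  have hmod := congrArg (· % (K : ℤ)) heq
  simp only [Int.add_mul_emod_self_left] at hmod
  rw [Int.emod_eq_of_lt (by omega) (by exact_mod_cast k.2),
    Int.emod_eq_of_lt (by omega) (by exact_mod_cast l.2)] at hmod
  exact Fin.ext (by exact_mod_cast hmod)

/-- If all but `m` of `2 * m + 1` numbers are close to `y / (m + 1)` and the others are bounded,
then their sum is close to `y`. -/
theorem abs_sub_sum_le {m : ℕ} {y η M : ℝ} {p : Fin (2 * m + 1) → ℝ} {B : Finset (Fin (2 * m + 1))}
    (hB : B.card ≤ m) (hη : ∀ k ∉ B, |p k - y / (m + 1)| ≤ η / (m + 1))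
    (hM : ∀ k, |p k| ≤ M / (m + 1)) : |y - ∑ k, p k| ≤ η + m * (M / (m + 1)) := by
  classical
  have hm : (0 : ℝ) < m + 1 := by positivity
  obtain ⟨G, hGB, hG⟩ : ∃ G ⊆ Bᶜ, G.card = m + 1 :=
    Finset.exists_subset_card_eq (by rw [Finset.card_compl, Fintype.card_fin]; omega)
  have hGc : Gᶜ.card = m := by rw [Finset.card_compl, Fintype.card_fin]; omega
  have h₁ : |∑ k ∈ G, (p k - y / (m + 1))| ≤ η := by
    refine (Finset.abs_sum_le_sum_abs _ _).trans ?_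
    refine (Finset.sum_le_card_nsmul _ _ _
      fun k hk => hη k (Finset.mem_compl.1 (hGB hk))).trans_eq ?_
    rw [hG, nsmul_eq_mul]
    push_cast
    field_simp
  have h₂ : |∑ k ∈ Gᶜ, p k| ≤ m * (M / (m + 1)) := by
    refine (Finset.abs_sum_le_sum_abs _ _).trans ?_
    refine (Finset.sum_le_card_nsmul _ _ _ fun k _ => hM k).trans_eq ?_
    rw [hGc, nsmul_eq_mul]
  have h₃ : y - ∑ k, p k = -(∑ k ∈ G, (p k - y / (m + 1))) - ∑ k ∈ Gᶜ, p k := by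
    rw [← Finset.sum_add_sum_compl G p, Finset.sum_sub_distrib, Finset.sum_const, hG, nsmul_eq_mul]
    push_cast
    field_simp
    ring
  rw [h₃]
  refine (abs_sub _ _).trans ?_
  rw [abs_neg]
  exact add_le_add h₁ h₂

/-- Prescribed bounded values at finitely many distinct points extend to the line. -/
theorem exists_extension_of_injective {κ : Type*} [Finite κ] {e : κ → ℝ}
    (he : Function.Injective e) (v : κ → ℝ) {M : ℝ} (hM : 0 ≤ M) (hv : ∀ i, |v i| ≤ M) :
    ∃ φ : ℝ →ᵇ ℝ, ‖φ‖ ≤ M ∧ ∀ i, φ (e i) = v i := by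
  let _ : TopologicalSpace κ := ⊥
  have : DiscreteTopology κ := ⟨rfl⟩
  let v' : κ →ᵇ ℝ := BoundedContinuousFunction.mkOfCompact ⟨v, continuous_of_discreteTopology⟩
  obtain ⟨φ, hφ, hφe⟩ := BoundedContinuousFunction.exists_extension_norm_eq_of_isClosedEmbedding v'
    ((continuous_of_discreteTopology (f := e)).isClosedEmbedding he)
  exact ⟨φ, hφ.trans_le ((BoundedContinuousFunction.norm_le hM).2 hv), congrFun hφe⟩

variable {m : ℕ}

/-- The inner function `x ↦ ∑ j, f j (x j)` on the cube. -/
def inner (f : Fin m → C(I, ℝ)) : C(Fin m → I, ℝ) :=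
  ∑ j, (f j).comp ⟨fun x => x j, continuous_apply j⟩

theorem inner_apply (f : Fin m → C(I, ℝ)) (x : Fin m → I) : inner f x = ∑ j, f j (x j) := by
  simp [inner]

theorem continuous_inner : Continuous (inner : (Fin m → C(I, ℝ)) → C(Fin m → I, ℝ)) := by
  unfold inner
  exact continuous_finsetSum _ fun j _ =>
    (ContinuousMap.continuous_precomp _).comp (continuous_apply j)

/-- The superposition `x ↦ ∑ k, φ k (∑ j, f k j (x j))`. -/
def superposition (f : Fin (2 * m + 1) → Fin m → C(I, ℝ)) (φ : Fin (2 * m + 1) → ℝ →ᵇ ℝ) :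
    C(Fin m → I, ℝ) :=
  ∑ k, (φ k).toContinuousMap.comp (inner (f k))

theorem superposition_apply (f : Fin (2 * m + 1) → Fin m → C(I, ℝ))
    (φ : Fin (2 * m + 1) → ℝ →ᵇ ℝ) (x : Fin m → I) :
    superposition f φ x = ∑ k, φ k (∑ j, f k j (x j)) := by
  simp [superposition, inner_apply]

/-- The inner functions for which `F` has a good approximation by a bounded superposition. -/
def approximating (F : C(Fin m → I, ℝ)) : Set (Fin (2 * m + 1) → Fin m → C(I, ℝ)) :=
  {f | ∃ φ : Fin (2 * m + 1) → ℝ →ᵇ ℝ, ‖φ‖ ≤ ‖F‖ ∧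
    ‖F - superposition f φ‖ < (2 * m + 1) / (2 * m + 2) * ‖F‖}

theorem isOpen_approximating (F : C(Fin m → I, ℝ)) : IsOpen (approximating F) := by
  have : approximating F = ⋃ φ ∈ {φ : Fin (2 * m + 1) → ℝ →ᵇ ℝ | ‖φ‖ ≤ ‖F‖},
      {f | ‖F - superposition f φ‖ < (2 * m + 1) / (2 * m + 2) * ‖F‖} := by
    ext f
    simp [approximating]
  rw [this]
  refine isOpen_biUnion fun φ _ => isOpen_lt ?_ continuous_const
  refine (continuous_const.sub ?_).norm
  exact continuous_finsetSum _ fun k _ =>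
    (ContinuousMap.continuous_postcomp _).comp (continuous_inner.comp (continuous_apply k))

theorem dense_approximating {F : C(Fin m → I, ℝ)} (hF : F ≠ 0) : Dense (approximating F) := by
  classical
  rw [Metric.dense_iff]
  intro f r hr
  have hF₀ : 0 < ‖F‖ := norm_pos_iff.2 hF
  have hm₀ : (0 : ℝ) < m + 1 := by positivity
  set K : ℝ := ((2 * m + 1 : ℕ) : ℝ) with hK_def
  have hK : 1 ≤ K := by rw [hK_def]; exact_mod_cast Nat.le_add_left 1 _
  obtain ⟨δ, hδ, hFδ⟩ := Metric.uniformContinuous_iff.1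
    (CompactSpace.uniformContinuous_of_continuous F.continuous) (‖F‖ / (4 * (m + 1)))
    (by positivity)
  obtain ⟨δ', hδ', hfδ⟩ := Metric.uniformContinuous_iff.1
    (CompactSpace.uniformContinuous_of_continuous
      (f := fun (t : I) (k : Fin (2 * m + 1)) (j : Fin m) => f k j t) (by fun_prop))
    (r / 4) (by positivity)
  obtain ⟨n, hn⟩ := exists_nat_one_div_lt (lt_min hδ hδ')
  set N := n + 1 with hN_def
  have hN : 0 < N := n.succ_pos
  have hNδ : (1 : ℝ) / N < min δ δ' := by rw [hN_def]; exact_mod_cast hn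
  let s : Fin (2 * m + 1) → ℝ := fun k => 1 - k / K
  have hs₀ : ∀ k, 0 ≤ s k := fun k => by
    have : (k : ℝ) ≤ K := by rw [hK_def]; exact_mod_cast k.2.le
    exact sub_nonneg.2 (div_le_one_of_le₀ this (by linarith))
  have hs₁ : ∀ k, s k ≤ 1 := fun k => sub_le_self _ (by positivity)
  choose c hc hinj using fun k : Fin (2 * m + 1) => exists_near_injective_sum
    (fun (j : Fin m) (i : Fin (N + 3)) => f k j (node N (s k) i)) (ε := r / 4) (by positivity)
  choose φ hφ hφc using fun k => exists_extension_of_injective (hinj k)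
    (fun i => F (fun j => node N (s k) (i j)) / (m + 1)) (M := ‖F‖ / (m + 1)) (by positivity)
    (fun i => by rw [abs_div, abs_of_pos hm₀]; gcongr; exact F.norm_coe_le_norm _)
  let g : Fin (2 * m + 1) → Fin m → C(I, ℝ) := fun k j => stair K N (s k) (c k j)
  refine ⟨g, ?_, φ, ?_, ?_⟩
  · have hgf : dist g f ≤ r / 2 := by
      refine (dist_pi_le_iff (by positivity)).2 fun k => (dist_pi_le_iff (by positivity)).2 fun j =>
        (ContinuousMap.dist_le (by positivity)).2 fun t => ?_
      refine abs_stair_sub_le hK (hs₀ k) (hs₁ k) fun i hi => ?_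
      have h₁ := hc k j i
      have h₂ := hfδ ((dist_node_le hN hi).trans_lt (hNδ.trans_le (min_le_right _ _)))
      have h₃ : |f k j (node N (s k) i) - f k j t| < r / 4 :=
        (dist_pi_lt_iff (by positivity)).1 ((dist_pi_lt_iff (by positivity)).1 h₂ k) j
      have := abs_sub_le (c k j i) (f k j (node N (s k) i)) (f k j t)
      linarith
    exact Metric.mem_ball.2 (hgf.trans_lt (half_lt_self hr))
  · refine (pi_norm_le_iff_of_nonneg hF₀.le).2 fun k => (hφ k).trans ?_
    exact div_le_self hF₀.le (by linarith [Nat.cast_nonneg (α := ℝ) m])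
  · have hbound : ‖F - superposition g φ‖ ≤ ‖F‖ / (4 * (m + 1)) + m * (‖F‖ / (m + 1)) := by
      refine (ContinuousMap.norm_le _ (by positivity)).2 fun x => ?_
      rw [ContinuousMap.sub_apply, superposition_apply, Real.norm_eq_abs]
      let gaps : Fin m → Finset (Fin (2 * m + 1)) := fun j =>
        Finset.univ.filter fun k => K * Int.fract ((N : ℝ) * x j + s k) < 1
      refine abs_sub_sum_le (B := Finset.univ.biUnion gaps) ?_ ?_ ?_
      · refine (Finset.card_biUnion_le_card_mul _ _ 1 fun j _ => ?_).trans (by simp)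
        refine Finset.card_le_one.2 fun k hk l hl => ?_
        exact eq_of_fract_lt _ (Finset.mem_filter.1 hk).2 (Finset.mem_filter.1 hl).2
      · intro k hk
        have hgood : ∀ j, 1 ≤ K * Int.fract ((N : ℝ) * x j + s k) := fun j => by
          by_contra hlt
          exact hk (Finset.mem_biUnion.2 ⟨j, Finset.mem_univ _, Finset.mem_filter.2
            ⟨Finset.mem_univ _, not_le.1 hlt⟩⟩)
        have hval := hφc k fun j => ⟨⌊(N : ℝ) * x j + s k⌋₊ + 1, gridIndex_lt (hs₁ k) (x j)⟩
        simp only [g, fun j => stair_eq_of_le_fract hK (hs₀ k) (hs₁ k) (c k j) (hgood j)]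
        rw [hval, ← sub_div, abs_div, abs_of_pos hm₀]
        gcongr
        refine (hFδ (lt_of_le_of_lt ((dist_pi_le_iff (by positivity)).2 fun j => ?_)
          (hNδ.trans_le (min_le_left _ _)))).le
        refine dist_node_le hN ?_
        have hw : 0 ≤ (N : ℝ) * x j + s k :=
          add_nonneg (mul_nonneg N.cast_nonneg (x j).2.1) (hs₀ k)
        have hf₁ := Nat.floor_le hw
        have hf₂ := Nat.lt_floor_add_one ((N : ℝ) * x j + s k)
        rw [abs_le]
        constructor <;> push_cast <;> linarith
      · exact fun k => ((φ k).norm_coe_le_norm _).trans (hφ k)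
    refine hbound.trans_lt ?_
    have : (2 * m + 1) / (2 * m + 2) * ‖F‖ - (‖F‖ / (4 * (m + 1)) + m * (‖F‖ / (m + 1))) =
        ‖F‖ / (4 * (m + 1)) := by
      field_simp
      ring
    have : 0 < ‖F‖ / (4 * (m + 1)) := by positivity
    linarith

/-- The superposition with fixed inner functions as a continuous linear map. -/
noncomputable def superpositionCLM (f : Fin (2 * m + 1) → Fin m → C(I, ℝ)) :
    (Fin (2 * m + 1) → ℝ →ᵇ ℝ) →L[ℝ] C(Fin m → I, ℝ) :=
  LinearMap.mkContinuous
    { toFun := superposition f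
      map_add' := fun φ ψ => by
        ext x
        simp [superposition_apply, Finset.sum_add_distrib]
      map_smul' := fun a φ => by
        ext x
        simp [superposition_apply, Finset.mul_sum] }
    (2 * m + 1) fun φ => by
      refine (ContinuousMap.norm_le _ (by positivity)).2 fun x => ?_
      change ‖superposition f φ x‖ ≤ _
      rw [superposition_apply]
      refine (norm_sum_le_of_le _ fun k _ =>
        ((φ k).norm_coe_le_norm _).trans (norm_le_pi_norm φ k)).trans_eq ?_
      simp

/-- There are universal inner functions: every continuous function on the cube is a superposition
with them. -/
theorem exists_surjective_superposition (m : ℕ) :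
    ∃ f : Fin (2 * m + 1) → Fin m → C(I, ℝ), Function.Surjective (superposition f) := by
  obtain ⟨D, hDc, hD⟩ := TopologicalSpace.exists_countable_dense C(Fin m → I, ℝ)
  have : BaireSpace (Fin (2 * m + 1) → Fin m → C(I, ℝ)) :=
    BaireSpace.of_completelyPseudoMetrizable
  obtain ⟨f, hf⟩ := (dense_biInter_of_isOpen (S := D \ {0}) (f := approximating)
    (fun F _ => isOpen_approximating F) (hDc.mono Set.sdiff_subset)
    (fun F hF => dense_approximating hF.2)).nonempty
  rw [Set.mem_iInter₂] at hf
  refine ⟨f, ?_⟩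
  set θ : ℝ := (2 * m + 1) / (2 * m + 2) with hθ
  have hθ₀ : 0 ≤ θ := by positivity
  have hθ₁ : θ < 1 := by rw [hθ, div_lt_one (by positivity)]; linarith
  refine surjective_of_approx (superpositionCLM f) (C := 2) (θ := (1 + θ) / 2) (by linarith)
    (by linarith) fun F => ?_
  rcases eq_or_ne F 0 with rfl | hF
  · exact ⟨0, by simp⟩
  have hF₀ : 0 < ‖F‖ := norm_pos_iff.2 hF
  obtain ⟨G, hG, hGD⟩ := Metric.dense_iff.1 hD F ((1 - θ) / 4 * ‖F‖)
    (mul_pos (by linarith) hF₀)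
  rw [Metric.mem_ball, dist_comm, dist_eq_norm] at hG
  have hG₀ : G ≠ 0 := by
    rintro rfl
    rw [sub_zero] at hG
    nlinarith
  obtain ⟨φ, hφ, hφG⟩ := hf G ⟨hGD, hG₀⟩
  have hGF : ‖G‖ ≤ ‖F‖ + (1 - θ) / 4 * ‖F‖ := by
    have := norm_le_norm_add_norm_sub F G
    linarith
  refine ⟨φ, by nlinarith, ?_⟩
  change ‖F - superposition f φ‖ ≤ _
  have h₁ : ‖F - superposition f φ‖ ≤ ‖F - G‖ + ‖G - superposition f φ‖ :=
    norm_sub_le_norm_sub_add_norm_sub _ _ _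
  have h₂ : θ * ‖G‖ ≤ θ * ‖F‖ + (1 - θ) / 4 * ‖F‖ := by
    calc θ * ‖G‖ ≤ θ * (‖F‖ + (1 - θ) / 4 * ‖F‖) := by gcongr
      _ = θ * ‖F‖ + θ * ((1 - θ) / 4 * ‖F‖) := by ring
      _ ≤ θ * ‖F‖ + (1 - θ) / 4 * ‖F‖ := by
        have : 0 ≤ (1 - θ) / 4 := by linarith
        exact add_le_add_right (mul_le_of_le_one_left (by positivity) hθ₁.le) _
  linarith

end KolmogorovArnold

/-- The Kolmogorov–Arnold representation theorem: any continuous function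
`F` on the unit cube `[0,1]^m` (for `m ≥ 2`) can be written as
`F(X) = Σ_{k=1}^{2m+1} Φ^k (Σ_{j=1}^m f^{kj} (X_j))` with all `Φ^k` continuous
on `ℝ` and all `f^{kj}` continuous on `[0,1]`. -/
theorem kolmogorov_arnold_representation (m : ℕ) (hm : 2 ≤ m)
    (F : (Fin m → ℝ) → ℝ)
    (hF : ContinuousOn F (Set.pi Set.univ fun _ : Fin m => Set.Icc (0:ℝ) 1)) :
    ∃ (Φ : Fin (2 * m + 1) → ℝ → ℝ) (f : Fin (2 * m + 1) → Fin m → ℝ → ℝ),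
      (∀ k, Continuous (Φ k)) ∧
      (∀ k j, ContinuousOn (f k j) (Set.Icc (0:ℝ) 1)) ∧
      (∀ X : Fin m → ℝ, (∀ j, X j ∈ Set.Icc (0:ℝ) 1) →
        F X = ∑ k, Φ k (∑ j, f k j (X j))) := by
  obtain ⟨f, hf⟩ := KolmogorovArnold.exists_surjective_superposition m
  let F' : C(Fin m → I, ℝ) :=
    ⟨fun x => F fun j => x j,
      hF.comp_continuous (by fun_prop) fun x j _ => (x j).2⟩
  obtain ⟨φ, hφ⟩ := hf F'
  refine ⟨fun k => φ k, fun k j => Set.IccExtend zero_le_one (f k j), fun k => (φ k).continuous,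
    fun k j => (f k j).continuous.Icc_extend'.continuousOn, fun X hX => ?_⟩
  have h := DFunLike.congr_fun hφ fun j => ⟨X j, hX j⟩
  rw [KolmogorovArnold.superposition_apply] at h
  simp only [fun k j => Set.IccExtend_of_mem zero_le_one (f k j) (hX j)]
  exact h.symm
end

section
/- Let M be an N×r real matrix all of whose rows M^1,…,M^N are nonzero, and let Y ∈ ℝ^N be such that the linear system M·Z = Y has at least one solution. Given an initial guess Z^0 ∈ ℝ^r, define the cyclic Kaczmarz iteration Z^{q+1} = Z^q + ((Y_{i(q)} − M^{i(q)}·Z^q)/‖M^{i(q)}‖²)·(M^{i(q)})ᵀ, where i(q) = (q mod N) + 1. Then the sequence (Z^q) converges, and its limit is the solution of M·Z = Y that is closest to Z^0 in the Euclidean norm, i.e. the orthogonal projection of Z^0 onto the affine solution set {Z ∈ ℝ^r : M·Z = Y}. -/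
open scoped RealInnerProductSpace

open Filter Topology

section Projection

variable {E : Type*} [NormedAddCommGroup E] [InnerProductSpace ℝ E]

/-- A Kaczmarz step lands on the hyperplane it projects onto. -/
lemma inner_kaczmarz_step {m : E} (hm : m ≠ 0) (y : ℝ) (z : E) :
    ⟪m, z + ((y - ⟪m, z⟫) / ‖m‖ ^ 2) • m⟫ = y := by
  have h : ‖m‖ ^ 2 ≠ 0 := pow_ne_zero 2 (norm_ne_zero_iff.mpr hm)
  rw [inner_add_right, inner_smul_right, real_inner_self_eq_norm_sq, div_mul_cancel₀ _ h]
  ring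

/-- Pythagoras for three points, with a right angle at `b`. -/
lemma norm_sub_sq_add_norm_sub_sq {a b c : E} (h : ⟪b - a, c - b⟫ = 0) :
    ‖c - a‖ ^ 2 = ‖b - a‖ ^ 2 + ‖c - b‖ ^ 2 := by
  rw [← sub_add_sub_cancel' b a c, norm_add_sq_real, h]
  ring

/-- If every step of `Z` is orthogonal to the vector from the new point to `W`, then the
distances to `W` decrease. -/
lemma antitone_norm_sub_of_inner_step_eq_zero {Z : ℕ → E} {W : E}
    (h : ∀ q, ⟪Z (q + 1) - Z q, W - Z (q + 1)⟫ = 0) : Antitone fun q => ‖W - Z q‖ := by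
  refine antitone_nat_of_succ_le fun q => ?_
  have := norm_sub_sq_add_norm_sub_sq (h q)
  exact (sq_le_sq₀ (norm_nonneg _) (norm_nonneg _)).mp (by nlinarith [sq_nonneg ‖Z (q + 1) - Z q‖])

/-- If every step of `Z` is orthogonal to the vector from the new point to `W`, then the
steps tend to zero. -/
lemma tendsto_step_of_inner_step_eq_zero {Z : ℕ → E} {W : E}
    (h : ∀ q, ⟪Z (q + 1) - Z q, W - Z (q + 1)⟫ = 0) :
    Tendsto (fun q => Z (q + 1) - Z q) atTop (𝓝 0) := by
  have hlim := tendsto_atTop_ciInf (antitone_norm_sub_of_inner_step_eq_zero h)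
    ⟨0, by rintro _ ⟨q, rfl⟩; exact norm_nonneg _⟩
  have hdiff := (hlim.pow 2).sub ((hlim.comp (tendsto_add_atTop_nat 1)).pow 2)
  rw [sub_self] at hdiff
  have hsq : Tendsto (fun q => ‖Z (q + 1) - Z q‖ ^ 2) atTop (𝓝 0) := by
    refine hdiff.congr fun q => ?_
    simp [norm_sub_sq_add_norm_sub_sq (h q)]
  rw [tendsto_zero_iff_norm_tendsto_zero]
  simpa [Real.sqrt_sq (norm_nonneg _)] using hsq.sqrt

end Projection

/-- If consecutive differences tend to zero, so do differences at any fixed lag. -/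
lemma tendsto_add_sub_of_tendsto_succ_sub {E : Type*} [AddCommGroup E] [TopologicalSpace E]
    [ContinuousAdd E] {Z : ℕ → E} (h : Tendsto (fun q => Z (q + 1) - Z q) atTop (𝓝 0)) (s : ℕ) :
    Tendsto (fun q => Z (q + s) - Z q) atTop (𝓝 0) := by
  induction s with
  | zero => simpa using tendsto_const_nhds
  | succ s ih =>
    have := (h.comp (tendsto_add_atTop_nat s)).add ih
    rw [add_zero] at this
    exact this.congr fun q => sub_add_sub_cancel _ _ _

/-- Every residue class is met among `N` consecutive integers. -/
lemma exists_lt_add_mod_eq {N i : ℕ} (hi : i < N) (q : ℕ) : ∃ s < N, (q + s) % N = i := by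
  have hq : q % N < N := Nat.mod_lt q (by omega)
  refine ⟨(i + (N - q % N)) % N, Nat.mod_lt _ (by omega), ?_⟩
  rw [Nat.add_mod_mod, ← Nat.mod_add_mod,
    show q % N + (i + (N - q % N)) = i + N by omega, Nat.add_mod_right, Nat.mod_eq_of_lt hi]

/-- Convergence of the cyclic Kaczmarz method for a consistent linear system:
if all rows `M i` are nonzero and the system `⟪M i, Z⟫ = Y i` has a solution,
then the cyclic Kaczmarz iteration starting from `Z 0` converges, and its limit
is the solution of the system closest to `Z 0` in the Euclidean norm (the
orthogonal projection of `Z 0` onto the affine solution set). -/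
theorem kaczmarz_cyclic_convergence (N r : ℕ) (hN : 0 < N)
    (M : Fin N → EuclideanSpace ℝ (Fin r)) (hM : ∀ i, M i ≠ 0)
    (Y : Fin N → ℝ)
    (hconsistent : ∃ W : EuclideanSpace ℝ (Fin r), ∀ i, ⟪M i, W⟫ = Y i)
    (Z : ℕ → EuclideanSpace ℝ (Fin r))
    (hZ : ∀ q : ℕ, Z (q + 1) = Z q +
      ((Y ⟨q % N, Nat.mod_lt q hN⟩ - ⟪M ⟨q % N, Nat.mod_lt q hN⟩, Z q⟫) /
        ‖M ⟨q % N, Nat.mod_lt q hN⟩‖ ^ 2) • M ⟨q % N, Nat.mod_lt q hN⟩) :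
    ∃ Zlim : EuclideanSpace ℝ (Fin r),
      Filter.Tendsto Z Filter.atTop (nhds Zlim) ∧
      (∀ i, ⟪M i, Zlim⟫ = Y i) ∧
      (∀ W : EuclideanSpace ℝ (Fin r), (∀ i, ⟪M i, W⟫ = Y i) →
        ‖Zlim - Z 0‖ ≤ ‖W - Z 0‖) := by
  set k : ℕ → Fin N := fun q => ⟨q % N, Nat.mod_lt q hN⟩
  have hstep (q : ℕ) :
      Z (q + 1) - Z q = ((Y (k q) - ⟪M (k q), Z q⟫) / ‖M (k q)‖ ^ 2) • M (k q) := by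
    rw [hZ q, add_sub_cancel_left]
  have hrow (q : ℕ) : ⟪M (k q), Z (q + 1)⟫ = Y (k q) := by
    rw [hZ q]
    exact inner_kaczmarz_step (hM _) _ _
  have horth {W : EuclideanSpace ℝ (Fin r)} (hW : ∀ i, ⟪M i, W⟫ = Y i) (q : ℕ) :
      ⟪Z (q + 1) - Z q, W - Z (q + 1)⟫ = 0 := by
    rw [hstep, inner_smul_left, inner_sub_right, hW, hrow, sub_self, mul_zero]
  obtain ⟨W₀, hW₀⟩ := hconsistent
  have hlag := tendsto_add_sub_of_tendsto_succ_sub (tendsto_step_of_inner_step_eq_zero (horth hW₀))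
  have hres (i : Fin N) : Tendsto (fun q => Y i - ⟪M i, Z q⟫) atTop (𝓝 0) := by
    have hbound : Tendsto
        (fun q => ‖M i‖ * ∑ s ∈ Finset.range N, ‖Z (q + (s + 1)) - Z q‖) atTop (𝓝 0) := by
      simpa using (tendsto_finsetSum (Finset.range N)
        fun s _ => (hlag (s + 1)).norm).const_mul ‖M i‖
    refine squeeze_zero_norm (fun q => ?_) hbound
    obtain ⟨s, hs, hsi⟩ := exists_lt_add_mod_eq i.isLt q
    have hki : k (q + s) = i := Fin.ext hsi
    rw [← hki, ← hrow (q + s), hki, ← inner_sub_right]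
    refine (norm_inner_le_norm _ _).trans (mul_le_mul_of_nonneg_left ?_ (norm_nonneg _))
    exact Finset.single_le_sum (f := fun s => ‖Z (q + (s + 1)) - Z q‖)
      (fun _ _ => norm_nonneg _) (Finset.mem_range.mpr hs)
  have hmem (q : ℕ) : Z q ∈ Metric.closedBall W₀ ‖W₀ - Z 0‖ := by
    rw [mem_closedBall_iff_norm']
    exact antitone_norm_sub_of_inner_step_eq_zero (horth hW₀) (Nat.zero_le q)
  obtain ⟨L, -, φ, hφ, hφL⟩ := (isCompact_closedBall W₀ ‖W₀ - Z 0‖).tendsto_subseq hmem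
  have hL (i : Fin N) : ⟪M i, L⟫ = Y i := by
    have h := ((tendsto_const_nhds (x := M i)).inner hφL).const_sub (Y i)
    exact (sub_eq_zero.mp (tendsto_nhds_unique h ((hres i).comp hφ.tendsto_atTop))).symm
  have hZL : Tendsto Z atTop (𝓝 L) := by
    have h : Tendsto (fun q => ‖L - Z q‖) atTop (𝓝 0) :=
      (tendsto_iff_tendsto_subseq_of_antitone
        (antitone_norm_sub_of_inner_step_eq_zero (horth hL)) hφ.tendsto_atTop).mpr
        (by simpa [Function.comp_def] using (hφL.const_sub L).norm)
    rw [tendsto_iff_norm_sub_tendsto_zero]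
    simpa only [norm_sub_rev] using h
  refine ⟨L, hZL, hL, fun W hW => ?_⟩
  have hperp (q : ℕ) : ⟪Z q - Z 0, W - L⟫ = 0 := by
    induction q with
    | zero => simp
    | succ q ih =>
      rw [← sub_add_sub_cancel (Z (q + 1)) (Z q), inner_add_left, ih, hstep, inner_smul_left,
        inner_sub_right, hW, hL, sub_self, mul_zero, add_zero]
  have hlim : ⟪L - Z 0, W - L⟫ = 0 :=
    tendsto_nhds_unique ((hZL.sub_const (Z 0)).inner tendsto_const_nhds) (by simp [hperp])
  have := norm_sub_sq_add_norm_sub_sq hlim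
  exact (sq_le_sq₀ (norm_nonneg _) (norm_nonneg _)).mp (by nlinarith [sq_nonneg ‖W - L‖])
end
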